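/- Let f : X → Y, let D be a probability mass function on X, let α ∈ (0,1), and let k be a natural number with k < supp_α(D.map f), where D.map f is the pushforward of D along f. Then every function h : X → Y that factors through a type of cardinality at most k (i.e., h = r ∘ u for some u : X → S and r : S → Y with |S| ≤ k) satisfies Pr_{x∼D}[h(x) = f(x)] < α; equivalently, its error Pr_{x∼D}[h(x) ≠ f(x)] is greater than 1 − α. -/

import Mathlib

open scoped ENNReal Classical

/-- The minimum support size of mass `α` for a probability mass function `P` on `Y`:
the least cardinality of a finite subset `A ⊆ Y` whose total `P`-mass is at least `α`. -/
noncomputable def minSupportSize {Y : Type*} (P : PMF Y) (α : ℝ≥0∞) : ℕ :=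
  sInf {n : ℕ | ∃ A : Finset Y, A.card = n ∧ α ≤ ∑ y ∈ A, P y}

/-- If `k < supp_α(D.map f)` then any function `h : X → Y` that factors through a type of
cardinality at most `k` satisfies `Pr_{x ∼ D}[h x = f x] < α`, equivalently its error
`Pr_{x ∼ D}[h x ≠ f x]` exceeds `1 - α`. -/
theorem factorsThrough_small_card_prob_eq_lt {X Y : Type*} (f : X → Y) (D : PMF X)
    (α : ℝ≥0∞) (hα : α ∈ Set.Ioo (0 : ℝ≥0∞) 1) (k : ℕ)
    (hk : k < minSupportSize (D.map f) α)
    (h : X → Y) (S : Type*) [Fintype S] (hS : Fintype.card S ≤ k)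
    (u : X → S) (r : S → Y) (hfactor : h = r ∘ u) :
    (∑' x, if h x = f x then D x else 0) < α ∧
      1 - α < ∑' x, if h x ≠ f x then D x else 0 := by
  have h1 : (∑' x, if h x = f x then D x else 0) < α := by
    by_contra hcon
    rw [not_lt] at hcon
    have hle : (∑' x, if h x = f x then D x else 0)
        ≤ ∑ y ∈ Finset.univ.image r, (D.map f) y := by
      simp only [PMF.map_apply]
      rw [← Summable.tsum_finsetSum (fun _ _ => ENNReal.summable)]
      refine ENNReal.tsum_le_tsum fun x => ?_
      split_ifs with hx
      · have hm : h x ∈ Finset.univ.image r := by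
          rw [hfactor]
          exact Finset.mem_image_of_mem r (Finset.mem_univ (u x))
        refine le_trans ?_ (Finset.single_le_sum (fun _ _ => zero_le) hm)
        simp [hx]
      · exact zero_le
    have hmin : minSupportSize (D.map f) α ≤ (Finset.univ.image r).card :=
      Nat.sInf_le ⟨_, rfl, hcon.trans hle⟩
    have hcard : (Finset.univ.image r).card ≤ Fintype.card S := Finset.card_image_le
    omega
  refine ⟨h1, ?_⟩
  have hsum : (∑' x, if h x = f x then D x else 0) + (∑' x, if h x ≠ f x then D x else 0) = 1 := by
    rw [← ENNReal.tsum_add, ← D.tsum_coe]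
    refine tsum_congr fun x => ?_
    by_cases hx : h x = f x <;> simp [hx]
  by_contra hcon
  rw [not_lt] at hcon
  have hfin : (∑' x, if h x ≠ f x then D x else 0) ≠ ⊤ :=
    ne_top_of_le_ne_top ENNReal.one_ne_top (hcon.trans tsub_le_self)
  have hlt := ENNReal.add_lt_add_of_lt_of_le hfin h1 hcon
  rw [hsum, add_tsub_cancel_of_le hα.2.le] at hlt
  exact lt_irrefl _ hlt
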